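/- Let ω and ρ be hermitian bounded linear functionals on a unital C*-algebra A. Then ρ lies in the weak* closure of ω∘E(A) if and only if there exist positive functionals ρ₁ and ρ₂ on A such that ρ = ρ₁ − ρ₂, ρ₁(1) = ω₊(1), ρ₂(1) = ω₋(1), and for every closed two-sided ideal J of A one has ‖ρ₁|J‖ ≤ ‖ω₊|J‖ and ‖ρ₂|J‖ ≤ ‖ω₋|J‖ (in particular ‖ρ|J‖ ≤ ‖ω|J‖). If ω is positive, this condition simplifies to: ρ(1) = ω(1) and ‖ρ|J‖ ≤ ‖ω|J‖ for all closed two-sided ideals J. -/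

import Mathlib

universe u

open scoped ComplexConjugate ComplexOrder

noncomputable section

variable {A : Type u} [NormedRing A] [StarRing A] [CStarRing A]
  [NormedAlgebra ℂ A] [StarModule ℂ A] [CompleteSpace A]

/-- A linear functional on a C*-algebra is positive if it is nonnegative
on all elements of the form `a* a`. -/
def IsPositiveFunctional (ω : A →L[ℂ] ℂ) : Prop :=
  ∀ a : A, 0 ≤ ω (star a * a)

/-- A state is a positive unital linear functional. -/
def IsState (ω : A →L[ℂ] ℂ) : Prop :=
  IsPositiveFunctional ω ∧ ω 1 = 1

/-- A hermitian (self-adjoint) linear functional. -/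
def IsHermitianFunctional (ω : A →L[ℂ] ℂ) : Prop :=
  ∀ a : A, ω (star a) = conj (ω a)

/-- `ωp`, `ωm` form the Jordan decomposition of the hermitian functional `ω`. -/
def IsJordanDecomposition (ω ωp ωm : A →L[ℂ] ℂ) : Prop :=
  IsPositiveFunctional ωp ∧ IsPositiveFunctional ωm ∧ ω = ωp - ωm ∧ ‖ω‖ = ‖ωp‖ + ‖ωm‖

/-- An element of a C*-algebra is positive iff it is of the form `b* b`. -/
def IsPositiveElem (c : A) : Prop :=
  ∃ b : A, c = star b * b

/-- `E(A)`: the unital completely positive elementary maps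
`x ↦ ∑ i, (a i)* x (a i)` with `∑ i, (a i)* (a i) = 1`. -/
def IsElementaryUCP (φ : A →L[ℂ] A) : Prop :=
  ∃ (n : ℕ) (a : Fin n → A), (∑ i, star (a i) * a i) = 1 ∧
    ∀ x : A, φ x = ∑ i, star (a i) * x * a i

/-- The set `ω ∘ E(A) = {ω ∘ φ : φ ∈ E(A)}`. -/
def mixSet (ω : A →L[ℂ] ℂ) : Set (A →L[ℂ] ℂ) :=
  {ρ | ∃ φ : A →L[ℂ] A, IsElementaryUCP φ ∧ ρ = ω.comp φ}

/-- Membership in the weak* closure of a set of functionals: every basic weak*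
neighbourhood of `ρ` (given by finitely many points and `ε > 0`) meets `S`. -/
def InWeakStarClosure (S : Set (A →L[ℂ] ℂ)) (ρ : A →L[ℂ] ℂ) : Prop :=
  ∀ ε : ℝ, 0 < ε → ∀ (n : ℕ) (x : Fin n → A), ∃ σ ∈ S, ∀ i, ‖ρ (x i) - σ (x i)‖ < ε

/-- Norm-closed two-sided ideals (which in a C*-algebra are automatically
`*`-closed `ℂ`-submodules). -/
def IsClosedIdeal (J : Set A) : Prop :=
  IsClosed J ∧ (0 : A) ∈ J ∧ (∀ x ∈ J, ∀ y ∈ J, x + y ∈ J) ∧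
    (∀ (c : ℂ), ∀ x ∈ J, c • x ∈ J) ∧ (∀ (a : A), ∀ x ∈ J, a * x ∈ J ∧ x * a ∈ J)

/-- The norm `‖ω|J‖` of the restriction of a functional `ω` to a subset `J`. -/
def normRestrict (ω : A →L[ℂ] ℂ) (J : Set A) : ℝ :=
  sSup {r : ℝ | ∃ x ∈ J, ‖x‖ ≤ 1 ∧ r = ‖ω x‖}

/-- The norm `‖cω‖` of the functional `x ↦ ω (c * x)`. -/
def mulNorm (ω : A →L[ℂ] ℂ) (c : A) : ℝ :=
  sSup {r : ℝ | ∃ x : A, ‖x‖ ≤ 1 ∧ r = ‖ω (c * x)‖}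

/-- A state `ω` is maximally mixed if every state `ρ` that is more mixed than `ω`
(i.e. `ρ` lies in the weak* closure of `ω ∘ E(A)`) satisfies in turn that `ω` is
more mixed than `ρ`. -/
def IsMaximallyMixed (ω : A →L[ℂ] ℂ) : Prop :=
  IsState ω ∧ ∀ ρ : A →L[ℂ] ℂ, IsState ρ →
    InWeakStarClosure (mixSet ω) ρ → InWeakStarClosure (mixSet ρ) ω

/-- Maximal (norm-closed two-sided) ideals. -/
def IsMaximalIdeal (N : Set A) : Prop :=
  IsClosedIdeal N ∧ N ≠ Set.univ ∧
    ∀ N' : Set A, IsClosedIdeal N' → N' ≠ Set.univ → N ⊆ N' → N' = N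

/-- The strong radical: the intersection of all maximal ideals. -/
def strongRadical (A : Type u) [NormedRing A] [StarRing A] [CStarRing A]
    [NormedAlgebra ℂ A] [StarModule ℂ A] [CompleteSpace A] : Set A :=
  ⋂₀ {N : Set A | IsMaximalIdeal N}

set_option linter.unusedSectionVars false
section helpers

variable {B : Type u} [CStarAlgebra B]

/-- The elementary map attached to a list of elements. -/
def emL (l : List B) : B →L[ℂ] B :=
  (l.map fun a => (ContinuousLinearMap.mul ℂ B (star a)).comp
    ((ContinuousLinearMap.mul ℂ B).flip a)).sum

lemma emL_nil (x : B) : emL ([] : List B) x = 0 := by simp [emL]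

lemma emL_cons (a : B) (l : List B) (x : B) :
    emL (a :: l) x = star a * x * a + emL l x := by simp [emL, mul_assoc]

lemma emL_append (l m : List B) (x : B) : emL (l ++ m) x = emL l x + emL m x := by
  simp [emL]

lemma emL_map_mul (l : List B) (s x : B) :
    emL (l.map (fun a => a * s)) x = star s * emL l x * s := by
  induction l with
  | nil => simp [emL_nil]
  | cons a l ih => simp only [List.map_cons, emL_cons, ih, star_mul, mul_add, add_mul, mul_assoc]

lemma emL_map_mul_left (l : List B) (s x : B) :
    emL (l.map (fun a => s * a)) x = emL l (star s * x * s) := by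
  induction l with
  | nil => simp [emL_nil]
  | cons a l ih => simp only [List.map_cons, emL_cons, ih, star_mul, mul_assoc]

lemma emL_star (l : List B) (x : B) : star (emL l x) = emL l (star x) := by
  induction l with
  | nil => simp [emL_nil]
  | cons a l ih => simp [emL_cons, ih, mul_assoc]

lemma emL_sum (l : List B) (x : B) : emL l x = ∑ i, star (l.get i) * x * l.get i := by
  induction l with
  | nil => simp [emL_nil]
  | cons a l ih => 
    rw [emL_cons, ih]
    simp [Fin.sum_univ_succ]

lemma emL_ucp (l : List B) (h : emL l 1 = 1) : IsElementaryUCP (emL l) := by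
  refine ⟨l.length, l.get, ?_, emL_sum l⟩
  rw [← h, emL_sum]; simp

lemma exists_emL_of_ucp {φ : B →L[ℂ] B} (h : IsElementaryUCP φ) : ∃ l, φ = emL l ∧ emL l 1 = 1 := by
  obtain ⟨n, a, h1, h2⟩ := h
  have key : ∀ x, emL (List.ofFn a) x = ∑ i, star (a i) * x * a i := by
    intro x
    simp [emL, List.map_ofFn, List.sum_ofFn, mul_assoc]
  refine ⟨List.ofFn a, ?_, ?_⟩
  · ext x; rw [h2, key]
  · rw [key]; simpa using h1

lemma emL_mem {J : Set B} (hJ : IsClosedIdeal J) (l : List B) {x : B} (hx : x ∈ J) :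
    emL l x ∈ J := by
  obtain ⟨-, h0, hadd, -, hmul⟩ := hJ
  induction l with
  | nil => simpa [emL_nil] using h0
  | cons a l ih =>
    rw [emL_cons]
    exact hadd _ ((hmul a _ ((hmul (star a) _ hx).1)).2) _ ih

variable [PartialOrder B] [StarOrderedRing B]

lemma emL_nonneg (l : List B) {x : B} (hx : 0 ≤ x) : 0 ≤ emL l x := by
  induction l with
  | nil => simp [emL_nil]
  | cons a l ih => rw [emL_cons]; exact add_nonneg (star_left_conjugate_nonneg hx a) ih

lemma emL_mono (l : List B) {x y : B} (h : x ≤ y) : emL l x ≤ emL l y := by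
  have := emL_nonneg l (sub_nonneg.2 h)
  rw [map_sub] at this
  exact sub_nonneg.1 this

lemma emL_schwarz_aux (l : List B) (x y : B) :
    0 ≤ emL l (star x * x) - emL l (star x) * y - star y * emL l x + star y * emL l 1 * y := by
  induction l with
  | nil => simp [emL_nil]
  | cons a l ih =>
    have h := add_nonneg (star_mul_self_nonneg (x * a - a * y)) ih
    convert h using 1
    simp only [emL_cons, star_sub, star_mul, mul_add, add_mul, mul_sub, sub_mul, mul_assoc, one_mul]
    abel

lemma emL_schwarz (l : List B) (h : emL l 1 = 1) (x : B) :
    star (emL l x) * emL l x ≤ emL l (star x * x) := by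
  have := emL_schwarz_aux l x (emL l x)
  rw [h, ← emL_star, mul_one] at this
  rw [← sub_nonneg]
  convert this using 1
  abel

lemma emL_norm_le (l : List B) (h : emL l 1 = 1) (x : B) : ‖emL l x‖ ≤ ‖x‖ := by
  have h1 : star (emL l x) * emL l x ≤ algebraMap ℝ B (‖x‖ ^ 2) := by
    refine (emL_schwarz l h x).trans ?_
    refine (emL_mono l CStarAlgebra.star_mul_le_algebraMap_norm_sq).trans ?_
    have : (algebraMap ℝ B (‖x‖ ^ 2)) = ((‖x‖^2 : ℝ) : ℂ) • (1 : B) := by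
      rw [Algebra.algebraMap_eq_smul_one, Complex.coe_smul]
    rw [this, map_smul, h]
  have h2 := (CStarAlgebra.norm_le_iff_le_algebraMap _ (by positivity) (star_mul_self_nonneg _)).2 h1
  rw [CStarRing.norm_star_mul_self] at h2
  nlinarith [norm_nonneg (emL l x), norm_nonneg x]

/-! positive functionals -/

lemma posf_nonneg {f : B →L[ℂ] ℂ} (hf : IsPositiveFunctional f) {a : B} (ha : 0 ≤ a) : 0 ≤ f a := by
  obtain ⟨b, rfl⟩ := CStarAlgebra.nonneg_iff_eq_star_mul_self.1 ha
  exact hf b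

lemma posf_mono {f : B →L[ℂ] ℂ} (hf : IsPositiveFunctional f) {a b : B} (h : a ≤ b) :
    f a ≤ f b := by
  have := posf_nonneg hf (sub_nonneg.2 h)
  rw [map_sub] at this
  exact sub_nonneg.1 this

lemma posf_mono_re {f : B →L[ℂ] ℂ} (hf : IsPositiveFunctional f) {a b : B} (h : a ≤ b) :
    (f a).re ≤ (f b).re := (Complex.le_def.1 (posf_mono hf h)).1

/-- positive functional as positive linear map -/
def posLM (f : B →L[ℂ] ℂ) (hf : IsPositiveFunctional f) : B →ₚ[ℂ] ℂ :=
  PositiveLinearMap.mk₀ f.toLinearMap (fun _ ha => posf_nonneg hf ha)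

lemma posf_star {f : B →L[ℂ] ℂ} (hf : IsPositiveFunctional f) : IsHermitianFunctional f := by
  intro a
  exact map_star (posLM f hf) a

lemma posf_cs {f : B →L[ℂ] ℂ} (hf : IsPositiveFunctional f) (a b : B) :
    ‖f (star a * b)‖ ^ 2 ≤ (f (star a * a)).re * (f (star b * b)).re := by
  let g := posLM f hf
  have h := norm_inner_le_norm (𝕜 := ℂ) (g.toPreGNS a) (g.toPreGNS b)
  rw [g.preGNS_inner_def] at h
  have h1 : ‖g.toPreGNS a‖ ^ 2 = (f (star a * a)).re := by
    have := congrArg Complex.re (g.preGNS_norm_sq (g.toPreGNS a))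
    norm_cast at this 
  have h2 : ‖g.toPreGNS b‖ ^ 2 = (f (star b * b)).re := by
    have := congrArg Complex.re (g.preGNS_norm_sq (g.toPreGNS b))
    norm_cast at this 
  rw [← h1, ← h2, ← mul_pow]
  exact pow_le_pow_left₀ (norm_nonneg _) h 2

lemma herm_re {f : B →L[ℂ] ℂ} (hf : IsHermitianFunctional f) (x : B) :
    f ((1/2 : ℂ) • (x + star x)) = ((f x).re : ℂ) := by
  rw [map_smul, map_add, hf, smul_eq_mul, Complex.add_conj]
  push_cast; ring

lemma half_sa (x : B) : IsSelfAdjoint ((1/2 : ℂ) • (x + star x)) := by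
  rw [isSelfAdjoint_iff]; simp [add_comm]

lemma half_norm (x : B) : ‖(1/2 : ℂ) • (x + star x)‖ ≤ ‖x‖ := by
  rw [norm_smul]
  have := norm_add_le x (star x)
  rw [norm_star] at this
  norm_num
  linarith

lemma exists_rot (z : ℂ) : ∃ θ : ℂ, ‖θ‖ = 1 ∧ θ * z = ‖z‖ := by
  by_cases hz : z = 0
  · exact ⟨1, by simp [hz]⟩
  · have h : (‖z‖ : ℂ) ≠ 0 := by simpa using hz
    refine ⟨conj z / ‖z‖, by simp [hz], ?_⟩
    rw [div_mul_eq_mul_div, mul_comm, Complex.mul_conj, Complex.normSq_eq_norm_sq]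
    push_cast
    field_simp

lemma herm_exists_sa {f : B →L[ℂ] ℂ} (hf : IsHermitianFunctional f) (x : B) :
    ∃ y : B, IsSelfAdjoint y ∧ ‖y‖ ≤ ‖x‖ ∧ f y = ‖f x‖ := by
  obtain ⟨θ, h1, h2⟩ := exists_rot (f x)
  refine ⟨_, half_sa (θ • x), (half_norm _).trans (by simp [norm_smul, h1]), ?_⟩
  rw [herm_re hf, map_smul, smul_eq_mul, h2]; simp

lemma sa_le_of_norm {y : B} (hy : IsSelfAdjoint y) {r : ℝ} (h : ‖y‖ ≤ r) :
    y ≤ algebraMap ℝ B r := by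
  refine hy.le_algebraMap_norm_self.trans ?_
  exact algebraMap_mono B h

lemma f_algebraMap (f : B →L[ℂ] ℂ) (r : ℝ) : f (algebraMap ℝ B r) = r * f 1 := by
  rw [Algebra.algebraMap_eq_smul_one, ← Complex.coe_smul, map_smul, smul_eq_mul]

lemma posf_norm_apply {f : B →L[ℂ] ℂ} (hf : IsPositiveFunctional f) (x : B) :
    ‖f x‖ ≤ (f 1).re * ‖x‖ := by
  obtain ⟨y, h1, h2, h3⟩ := herm_exists_sa (posf_star hf) x
  have := posf_mono_re hf (sa_le_of_norm h1 h2)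
  rw [h3, f_algebraMap] at this
  simpa [mul_comm] using this

lemma posf_one_nonneg {f : B →L[ℂ] ℂ} (hf : IsPositiveFunctional f) : 0 ≤ (f 1).re :=
  (Complex.le_def.1 (posf_nonneg hf zero_le_one)).1

lemma posf_im {f : B →L[ℂ] ℂ} (hf : IsPositiveFunctional f) {a : B} (ha : 0 ≤ a) : (f a).im = 0 :=
  ((Complex.le_def.1 (posf_nonneg hf ha)).2).symm

lemma posf_norm {f : B →L[ℂ] ℂ} (hf : IsPositiveFunctional f) : ‖f‖ = (f 1).re := by
  apply le_antisymm
  · exact f.opNorm_le_bound (posf_one_nonneg hf) (posf_norm_apply hf)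
  · rcases subsingleton_or_nontrivial B with h | h
    · have : (1 : B) = 0 := Subsingleton.elim _ _
      rw [this]; simp
    · have := f.le_opNorm 1
      rw [CStarRing.norm_one, mul_one] at this
      exact (Complex.re_le_norm _).trans this


lemma le_normRestrict (f : B →L[ℂ] ℂ) {J : Set B} {x : B} (hx : x ∈ J) (h : ‖x‖ ≤ 1) :
    ‖f x‖ ≤ normRestrict f J := by
  refine le_csSup ⟨‖f‖, ?_⟩ ⟨x, hx, h, rfl⟩
  rintro r ⟨y, -, hy, rfl⟩
  exact (f.le_opNorm y).trans (mul_le_of_le_one_right (norm_nonneg _) hy)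

lemma normRestrict_le (f : B →L[ℂ] ℂ) {J : Set B} (hJ : IsClosedIdeal J) {C : ℝ}
    (h : ∀ x ∈ J, ‖x‖ ≤ 1 → ‖f x‖ ≤ C) : normRestrict f J ≤ C := by
  refine csSup_le ⟨_, 0, hJ.2.1, by simp, rfl⟩ ?_
  rintro r ⟨y, hy, hy1, rfl⟩
  exact h y hy hy1

lemma exists_lt_normRestrict (f : B →L[ℂ] ℂ) {J : Set B} (hJ : IsClosedIdeal J) {C : ℝ}
    (h : C < normRestrict f J) : ∃ x ∈ J, ‖x‖ ≤ 1 ∧ C < ‖f x‖ := by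
  by_contra! hc
  exact absurd (normRestrict_le f hJ hc) (not_le.2 h)

lemma closure_one {ω ρ : B →L[ℂ] ℂ} (h : InWeakStarClosure (mixSet ω) ρ) : ρ 1 = ω 1 := by
  rw [← sub_eq_zero, ← norm_eq_zero]
  refine le_antisymm (le_of_forall_pos_le_add fun ε hε => ?_) (norm_nonneg _)
  obtain ⟨σ, ⟨φ, hφ, rfl⟩, hs⟩ := h ε hε 1 (fun _ => 1)
  obtain ⟨l, rfl, hl⟩ := exists_emL_of_ucp hφ
  have := hs 0
  simp only [ContinuousLinearMap.comp_apply, hl] at this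
  linarith

lemma closure_pos {ω ρ : B →L[ℂ] ℂ} (hω : IsPositiveFunctional ω)
    (h : InWeakStarClosure (mixSet ω) ρ) : IsPositiveFunctional ρ := by
  intro a
  have key : ∀ ε > 0, ∃ z : ℂ, 0 ≤ z ∧ ‖ρ (star a * a) - z‖ < ε := by
    intro ε hε
    obtain ⟨σ, ⟨φ, hφ, rfl⟩, hs⟩ := h ε hε 1 (fun _ => star a * a)
    obtain ⟨l, rfl, hl⟩ := exists_emL_of_ucp hφ
    exact ⟨_, posf_nonneg hω (emL_nonneg l (star_mul_self_nonneg a)), hs 0⟩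
  have hcl : IsClosed {z : ℂ | 0 ≤ z} := isClosed_Ici
  have : ρ (star a * a) ∈ closure {z : ℂ | 0 ≤ z} := by
    rw [Metric.mem_closure_iff]
    intro ε hε
    obtain ⟨z, h1, h2⟩ := key ε hε
    exact ⟨z, h1, by rwa [dist_eq_norm]⟩
  rwa [hcl.closure_eq] at this

lemma closure_normRestrict {ω ρ : B →L[ℂ] ℂ} (h : InWeakStarClosure (mixSet ω) ρ) {J : Set B}
    (hJ : IsClosedIdeal J) : normRestrict ρ J ≤ normRestrict ω J := by
  refine normRestrict_le ρ hJ fun x hx hx1 => le_of_forall_pos_le_add fun ε hε => ?_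
  obtain ⟨σ, ⟨φ, hφ, rfl⟩, hs⟩ := h ε hε 1 (fun _ => x)
  obtain ⟨l, rfl, hl⟩ := exists_emL_of_ucp hφ
  have h1 := le_normRestrict ω (emL_mem hJ l hx) ((emL_norm_le l hl x).trans hx1)
  have h2 := hs 0
  simp only [ContinuousLinearMap.comp_apply] at h2
  have h3 := norm_le_norm_add_norm_sub' (ρ x) (ω (emL l x))
  linarith

open Filter Topology in
lemma closure_split {ω ωp ωm ρ : B →L[ℂ] ℂ} (hsub : ω = ωp - ωm)
    (h : InWeakStarClosure (mixSet ω) ρ) :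
    ∃ ρ₁ ρ₂ : B →L[ℂ] ℂ, ρ = ρ₁ - ρ₂ ∧ InWeakStarClosure (mixSet ωp) ρ₁ ∧
      InWeakStarClosure (mixSet ωm) ρ₂ := by
  classical
  have h0 : ∀ i : Finset B × ℕ, ∃ l : List B, emL l 1 = 1 ∧
      ∀ x ∈ i.1, ‖ρ x - ω (emL l x)‖ < 1 / ((i.2 : ℝ) + 1) := by
    rintro ⟨F, n⟩
    obtain ⟨σ, ⟨φ, hφ, rfl⟩, hs⟩ := h (1 / ((n : ℝ) + 1)) (by positivity) F.card
      (fun i => (F.equivFin.symm i : B))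
    obtain ⟨l, rfl, hl⟩ := exists_emL_of_ucp hφ
    refine ⟨l, hl, fun x hx => ?_⟩
    have := hs (F.equivFin ⟨x, hx⟩)
    simpa using this
  choose l hl1 hl using h0
  have hten : ∀ x, Tendsto (fun i => ω (emL (l i) x)) atTop (𝓝 (ρ x)) := by
    intro x
    rw [Metric.tendsto_nhds]
    intro ε hε
    obtain ⟨n, hn⟩ := exists_nat_one_div_lt hε
    refine Filter.mem_of_superset (Filter.Ici_mem_atTop (({x}, n) : Finset B × ℕ)) ?_
    rintro ⟨F, m⟩ ⟨hF, hm⟩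
    simp only [Set.mem_ofPred_eq]
    rw [dist_comm, dist_eq_norm]
    have := hl (F, m) x (hF (by simp))
    refine this.trans_le (le_trans ?_ hn.le)
    apply one_div_le_one_div_of_le (by positivity)
    have : (n : ℝ) ≤ m := by exact_mod_cast hm
    simpa using this
  let U : Ultrafilter (Finset B × ℕ) := Ultrafilter.of atTop
  have hU : (U : Filter (Finset B × ℕ)) ≤ atTop := Ultrafilter.of_le _
  let F : Finset B × ℕ → WeakDual ℂ B := fun i => StrongDual.toWeakDual (ωp.comp (emL (l i)))
  have hball := (WeakDual.isCompact_closedBall (𝕜 := ℂ) (E := B) 0 ‖ωp‖).ultrafilter_le_nhds'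
    (U.map F) (by
      rw [Ultrafilter.mem_map]
      apply Filter.univ_mem'
      intro i
      simp only [F, Set.mem_preimage, Metric.mem_closedBall, dist_zero_right]
      refine ContinuousLinearMap.opNorm_le_bound _ (norm_nonneg _) fun x => ?_
      exact (ωp.le_opNorm _).trans (mul_le_mul_of_nonneg_left (emL_norm_le _ (hl1 i) x)
        (norm_nonneg _)))
  obtain ⟨ρw, -, hρw⟩ := hball
  let ρ₁ : B →L[ℂ] ℂ := WeakDual.toStrongDual ρw
  have hten1 : ∀ x, Tendsto (fun i => ωp (emL (l i) x)) U (𝓝 (ρ₁ x)) := by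
    intro x
    have hc : Tendsto F U (𝓝 ρw) := hρw
    exact ((WeakDual.eval_continuous x).tendsto ρw).comp hc
  have hten2 : ∀ x, Tendsto (fun i => ωm (emL (l i) x)) U (𝓝 ((ρ₁ - ρ) x)) := by
    intro x
    have := (hten1 x).sub ((hten x).mono_left hU)
    have he : (ρ₁ - ρ) x = ρ₁ x - ρ x := rfl
    rw [he]
    convert this using 2 with i
    rw [hsub]; simp
  have key : ∀ (f g : B →L[ℂ] ℂ), (∀ x, Tendsto (fun i => f (emL (l i) x)) U (𝓝 (g x))) →
      InWeakStarClosure (mixSet f) g := by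
    intro f g hfg ε hε n x
    have : ∀ᶠ i in (U : Filter _), ∀ k : Fin n, dist (f (emL (l i) (x k))) (g (x k)) < ε := by
      rw [eventually_all]
      intro k
      exact Metric.tendsto_nhds.1 (hfg (x k)) ε hε
    obtain ⟨i, hi⟩ := this.exists
    refine ⟨_, ⟨_, emL_ucp _ (hl1 i), rfl⟩, fun k => ?_⟩
    have := hi k
    rwa [dist_comm, dist_eq_norm] at this
  exact ⟨ρ₁, ρ₁ - ρ, by simp, key _ _ hten1, key _ _ hten2⟩

/-- closed two-sided ideal generated by an element -/
def genIdeal (e : B) : Submodule ℂ B :=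
  (Submodule.span ℂ (Set.range fun p : B × B => p.1 * e * p.2)).topologicalClosure

lemma genIdeal_base (e a b : B) : a * e * b ∈ genIdeal e :=
  Submodule.le_topologicalClosure _ (Submodule.subset_span ⟨(a, b), rfl⟩)

lemma self_mem_genIdeal (e : B) : e ∈ genIdeal e := by
  simpa using genIdeal_base e 1 1

/-- closedness and induction principle for the generated ideal -/
lemma genIdeal_induction (e : B) (p : B → Prop) (hb : ∀ a b, p (a * e * b)) (h0 : p 0)
    (hadd : ∀ x y, p x → p y → p (x + y)) (hsmul : ∀ (c : ℂ) x, p x → p (c • x))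
    (hcl : ∀ x, (∀ ε > 0, ∃ y, p y ∧ ‖x - y‖ < ε) → p x) : ∀ x ∈ genIdeal e, p x := by
  intro x hx
  have hx' : x ∈ closure (Submodule.span ℂ (Set.range fun p : B × B => p.1 * e * p.2) : Set B) := hx
  rw [Metric.mem_closure_iff] at hx'
  refine hcl x fun ε hε => ?_
  obtain ⟨y, hy, hxy⟩ := hx' ε hε
  refine ⟨y, ?_, by rwa [dist_eq_norm] at hxy⟩
  refine Submodule.span_induction (p := fun y _ => p y) ?_ h0 (fun x y _ _ => hadd x y)
    (fun c x _ => hsmul c x) hy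
  rintro _ ⟨⟨a, b⟩, rfl⟩
  exact hb a b

lemma genIdeal_isClosed (e : B) : IsClosed (genIdeal e : Set B) :=
  Submodule.isClosed_topologicalClosure _

lemma genIdeal_map (e : B) (T : B → B) (hT0 : T 0 = 0) (hTa : ∀ x y, T (x + y) = T x + T y)
    (hTs : ∀ (c : ℂ) x, ∃ d : ℂ, T (c • x) = d • T x) (hTc : Continuous T)
    (hb : ∀ a b, T (a * e * b) ∈ genIdeal e) :
    ∀ x ∈ genIdeal e, T x ∈ genIdeal e := by
  refine genIdeal_induction e _ hb ?_ ?_ ?_ ?_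
  · rw [hT0]; exact Submodule.zero_mem _
  · intro x y hx hy; rw [hTa]; exact Submodule.add_mem _ hx hy
  · intro c x hx
    obtain ⟨d, hd⟩ := hTs c x
    rw [hd]; exact Submodule.smul_mem _ _ hx
  · intro x hx
    have hcl : IsClosed (T ⁻¹' (genIdeal e : Set B)) := (genIdeal_isClosed e).preimage hTc
    have : x ∈ closure (T ⁻¹' (genIdeal e : Set B)) := by
      rw [Metric.mem_closure_iff]
      intro ε hε
      obtain ⟨y, hy, hxy⟩ := hx ε hε
      exact ⟨y, hy, by rwa [dist_eq_norm]⟩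
    rwa [hcl.closure_eq] at this

lemma genIdeal_closedIdeal (e : B) : IsClosedIdeal (genIdeal e : Set B) := by
  refine ⟨genIdeal_isClosed e, Submodule.zero_mem _, fun x hx y hy => Submodule.add_mem _ hx hy,
    fun c x hx => Submodule.smul_mem _ _ hx, fun a x hx => ⟨?_, ?_⟩⟩
  · refine genIdeal_map e (fun x => a * x) (by simp) (by simp [mul_add])
      (fun c x => ⟨c, by simp⟩) (by fun_prop) (fun b c => ?_) x hx
    simpa [mul_assoc] using genIdeal_base e (a * b) c
  · refine genIdeal_map e (fun x => x * a) (by simp) (by simp [add_mul])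
      (fun c x => ⟨c, by simp⟩) (by fun_prop) (fun b c => ?_) x hx
    simpa [mul_assoc] using genIdeal_base e b (c * a)

lemma genIdeal_star {e : B} (he : IsSelfAdjoint e) {x : B} (hx : x ∈ genIdeal e) :
    star x ∈ genIdeal e := by
  refine genIdeal_map e (fun x => star x) (by simp) (by simp)
      (fun c x => ⟨conj c, by simp⟩) continuous_star (fun b c => ?_) x hx
  simpa [mul_assoc, he.star_eq] using genIdeal_base e (star c) (star b)

lemma one_add_facts {z : B} (hz : 0 ≤ z) : ∃ v : B, IsSelfAdjoint v ∧ v * (1 + z) * v = 1 ∧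
    v * v * (1 + z) = 1 ∧ (1 + z) * (v * v) = 1 ∧ v * v ≤ 1 ∧
    Ring.inverse (1 + z) = v * v := by
  have h1 : IsStrictlyPositive (1 + z) := IsStrictlyPositive.add_nonneg (by cfc_tac) hz
  have hu := h1.isUnit
  obtain ⟨k, hk⟩ := hu
  have hk0 : 0 ≤ (k : B) := by rw [hk]; exact h1.nonneg
  have hinv : 0 ≤ ((k⁻¹ : Bˣ) : B) := by
    have h := star_left_conjugate_nonneg hk0 ((k⁻¹ : Bˣ) : B)
    rw [mul_assoc, Units.mul_inv, mul_one] at h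
    have h2 := h.isSelfAdjoint.star_eq
    rw [star_star] at h2
    rwa [h2]
  let v := CFC.sqrt ((k⁻¹ : Bˣ) : B)
  have hv : 0 ≤ v := CFC.sqrt_nonneg _
  have hvv : v * v = ((k⁻¹ : Bˣ) : B) := CFC.sqrt_mul_sqrt_self _ hinv
  have hvu : IsUnit v := (CFC.isUnit_sqrt_iff _ hinv).2 (Units.isUnit _)
  have e1 : v * v * (1 + z) = 1 := by rw [hvv, ← hk]; simp
  have e2 : (1 + z) * (v * v) = 1 := by rw [hvv, ← hk]; simp
  refine ⟨v, hv.isSelfAdjoint, ?_, e1, e2, ?_, ?_⟩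
  · apply hvu.mul_left_cancel
    rw [← mul_assoc, ← mul_assoc, e1, one_mul, mul_one]
  · rw [hvv]
    apply CStarAlgebra.inv_le_one
    rw [← Units.val_le_val, hk]
    simpa using hz
  · rw [← hk, Ring.inverse_unit, hvv]

lemma norm_le_one_of {u : B} (h0 : 0 ≤ u) (h1 : u ≤ 1) : ‖u‖ ≤ 1 :=
  (CStarAlgebra.norm_le_one_iff_of_nonneg u h0).2 h1

lemma sa_mul_self_nonneg {v : B} (hv : IsSelfAdjoint v) : 0 ≤ v * v := by
  have := star_mul_self_nonneg v
  rwa [hv.star_eq] at this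

lemma inv_mul_norm {z q : B} (hq : star q * q ≤ z) : ‖Ring.inverse (1 + z) * star q‖ ≤ 1 := by
  have hz : 0 ≤ z := (star_mul_self_nonneg q).trans hq
  obtain ⟨v, hv, h1, h2, h3, h4, h5⟩ := one_add_facts hz
  rw [h5]
  set w := v * v with hw
  have hw0 : 0 ≤ w := sa_mul_self_nonneg hv
  have hws : star w = w := hw0.isSelfAdjoint.star_eq
  have : star (q * w) * (q * w) ≤ 1 := by
    calc star (q * w) * (q * w) = star w * (star q * q) * w := by simp [mul_assoc]
      _ ≤ star w * (1 + z) * w := star_left_conjugate_le_conjugate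
          (hq.trans (by simp)) w
      _ = w := by rw [hws, h2, one_mul]
      _ ≤ 1 := h4
  have h6 := norm_le_one_of (star_mul_self_nonneg _) this
  rw [CStarRing.norm_star_mul_self] at h6
  have h7 : ‖w * star q‖ = ‖q * w‖ := by
    rw [← norm_star (q * w), star_mul, hws]
  rw [h7]
  nlinarith [norm_nonneg (q * w)]

lemma inv_norm {z : B} (hz : 0 ≤ z) : ‖Ring.inverse (1 + z)‖ ≤ 1 := by
  obtain ⟨v, hv, h1, h2, h3, h4, h5⟩ := one_add_facts hz
  rw [h5]
  exact norm_le_one_of (sa_mul_self_nonneg hv) h4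

lemma approx_unit {e : B} (he : IsSelfAdjoint e) : ∀ y ∈ genIdeal e, ∀ ε > 0, ∃ l : List B,
    ∀ z, emL l (e * e) ≤ z → ‖Ring.inverse (1 + z) * y‖ < ε := by
  have hee := sa_mul_self_nonneg he
  refine genIdeal_induction e _ ?_ ?_ ?_ ?_ ?_
  · intro a b ε hε
    let t : ℝ := (‖b‖ + 1) / ε
    have ht : 0 < t := by positivity
    refine ⟨[(t : ℂ) • star a], fun z hz => ?_⟩
    have hq : star (e * ((t : ℂ) • star a)) * (e * ((t : ℂ) • star a)) ≤ z := by
      refine le_trans (le_of_eq ?_) hz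
      simp only [emL_cons, emL_nil, add_zero, star_mul, he.star_eq, mul_assoc]
    have h1 := inv_mul_norm hq
    have h2 : star (e * ((t : ℂ) • star a)) = (t : ℂ) • (a * e) := by
      simp [he.star_eq]
    rw [h2, mul_smul_comm, norm_smul] at h1
    simp only [Complex.norm_real, Real.norm_eq_abs, abs_of_pos ht] at h1
    have h3 : ‖Ring.inverse (1 + z) * (a * e)‖ ≤ 1 / t := by
      rw [le_div_iff₀ ht]; linarith
    calc ‖Ring.inverse (1 + z) * (a * e * b)‖
        = ‖Ring.inverse (1 + z) * (a * e) * b‖ := by simp only [mul_assoc]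
      _ ≤ 1 / t * ‖b‖ := (norm_mul_le _ _).trans (by gcongr)
      _ = ε * (‖b‖ / (‖b‖ + 1)) := by simp only [t]; field_simp
      _ < ε * 1 := by
        gcongr
        rw [div_lt_one (by positivity)]; linarith
      _ = ε := mul_one _
  · intro ε hε
    exact ⟨[], fun z _ => by simpa using hε⟩
  · intro x y hx hy ε hε
    obtain ⟨l1, h1⟩ := hx (ε / 2) (by positivity)
    obtain ⟨l2, h2⟩ := hy (ε / 2) (by positivity)
    refine ⟨l1 ++ l2, fun z hz => ?_⟩
    rw [emL_append] at hz
    have a1 := h1 z ((le_add_of_nonneg_right (emL_nonneg l2 hee)).trans hz)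
    have a2 := h2 z ((le_add_of_nonneg_left (emL_nonneg l1 hee)).trans hz)
    rw [mul_add]
    exact (norm_add_le _ _).trans_lt (by linarith)
  · intro c x hx ε hε
    obtain ⟨l, h⟩ := hx (ε / (‖c‖ + 1)) (by positivity)
    refine ⟨l, fun z hz => ?_⟩
    have := h z hz
    rw [lt_div_iff₀ (by positivity)] at this
    rw [mul_smul_comm, norm_smul]
    nlinarith [norm_nonneg (Ring.inverse (1 + z) * x)]
  · intro x hx ε hε
    obtain ⟨y, hy, hxy⟩ := hx (ε / 2) (by positivity)
    obtain ⟨l, h⟩ := hy (ε / 2) (by positivity)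
    refine ⟨l, fun z hz => ?_⟩
    have hz0 : 0 ≤ z := (emL_nonneg l hee).trans hz
    have h1 := h z hz
    have h2 : Ring.inverse (1 + z) * x = Ring.inverse (1 + z) * y + Ring.inverse (1 + z) * (x - y) := by
      rw [← mul_add]; simp
    rw [h2]
    have h3 : ‖Ring.inverse (1 + z) * (x - y)‖ ≤ 1 * ‖x - y‖ :=
      (norm_mul_le _ _).trans (by gcongr; exact inv_norm hz0)
    exact (norm_add_le _ _).trans_lt (by linarith)

lemma posf_comp_emL {f : B →L[ℂ] ℂ} (hf : IsPositiveFunctional f) (l : List B) :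
    IsPositiveFunctional (f.comp (emL l)) :=
  fun a => posf_nonneg hf (emL_nonneg l (star_mul_self_nonneg a))

lemma step_core {ω : B →L[ℂ] ℂ} (hω : IsPositiveFunctional ω) {e : B} (he : IsSelfAdjoint e)
    {h : B} (hh0 : 0 ≤ h) (hh1 : h ≤ 1) (hh : h ∈ genIdeal e) {ε : ℝ} (hε : 0 < ε) :
    ∃ (c : List B) (s : B), IsSelfAdjoint s ∧ h + s * emL c (e * e) * s ≤ 1 ∧
      normRestrict ω (genIdeal e : Set B) - ε ≤ (ω (h + s * emL c (e * e) * s)).re := by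
  have hee := sa_mul_self_nonneg he
  have hJ := genIdeal_closedIdeal e
  obtain ⟨y, hyJ, hy1, hy⟩ := exists_lt_normRestrict ω hJ
    (show normRestrict ω (genIdeal e : Set B) - ε / 2 < normRestrict ω (genIdeal e : Set B) by linarith)
  let s := CFC.sqrt (1 - h)
  have hs0 : 0 ≤ s := CFC.sqrt_nonneg _
  have hss : s * s = 1 - h := CFC.sqrt_mul_sqrt_self _ (sub_nonneg.2 hh1)
  have hsn : ‖s‖ ≤ 1 := by
    have h1 : ‖s * s‖ ≤ 1 := by
      rw [hss]; exact norm_le_one_of (sub_nonneg.2 hh1) (by simpa using hh0)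
    have h2 : ‖star s * s‖ = ‖s‖ * ‖s‖ := CStarRing.norm_star_mul_self
    rw [hs0.isSelfAdjoint.star_eq] at h2
    nlinarith [norm_nonneg s]
  have hone : ‖(1 : B)‖ ≤ 1 := norm_le_one_of zero_le_one le_rfl
  let r := 1 - s
  have hrn : ‖r‖ ≤ 2 := (norm_sub_le _ _).trans (by linarith)
  have hrs : star r = r := by simp [r, hs0.isSelfAdjoint.star_eq]
  have hrJ : r ∈ genIdeal e := by
    obtain ⟨v, -, -, -, h3, -, -⟩ := one_add_facts hs0
    have h4 : h = (1 - s) * (1 + s) := by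
      have : (1 - s) * (1 + s) = 1 - s * s := by noncomm_ring
      rw [this, hss]; simp
    have h5 : r = h * (v * v) := by
      rw [h4, mul_assoc, h3, mul_one]
    rw [h5]
    exact (hJ.2.2.2.2 (v * v) h hh).2
  let δ := ε / (12 * (‖ω‖ + 1))
  have hδ : 0 < δ := by positivity
  have hδω : 6 * δ * ‖ω‖ ≤ ε / 2 := by
    have h1 : 6 * δ * (‖ω‖ + 1) = ε / 2 := by simp only [δ]; field_simp; norm_num
    nlinarith
  obtain ⟨l1, hl1⟩ := approx_unit he y hyJ δ hδ
  obtain ⟨l2, hl2⟩ := approx_unit he (star y) (genIdeal_star he hyJ) δ hδ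
  obtain ⟨l3, hl3⟩ := approx_unit he r hrJ δ hδ
  let l := l1 ++ (l2 ++ l3)
  let z := emL l (e * e)
  have hz : z = emL l1 (e * e) + (emL l2 (e * e) + emL l3 (e * e)) := by
    simp only [z, l, emL_append]
  have p1 := emL_nonneg l1 hee
  have p2 := emL_nonneg l2 hee
  have p3 := emL_nonneg l3 hee
  have hz0 : 0 ≤ z := emL_nonneg l hee
  have k1 := hl1 z (by rw [hz]; exact le_add_of_nonneg_right (add_nonneg p2 p3))
  have k2 := hl2 z (by
    rw [hz]; exact (le_add_of_nonneg_right p3).trans (le_add_of_nonneg_left p1))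
  have k3 := hl3 z (by
    rw [hz]; exact (le_add_of_nonneg_left p2).trans (le_add_of_nonneg_left p1))
  obtain ⟨v, hv, f1, f2, f3, f4, f5⟩ := one_add_facts hz0
  rw [f5] at k1 k2 k3
  set w := v * v with hw
  have hw0 : 0 ≤ w := sa_mul_self_nonneg hv
  have hws : star w = w := hw0.isSelfAdjoint.star_eq
  let u := 1 - w
  have hu0 : 0 ≤ u := sub_nonneg.2 f4
  have hu1 : u ≤ 1 := by simpa [u] using hw0
  have hun := norm_le_one_of hu0 hu1
  have hus : star u = u := hu0.isSelfAdjoint.star_eq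
  have hc : emL (l.map fun a => a * v) (e * e) = u := by
    rw [emL_map_mul, hv.star_eq]
    have : v * (1 + z) * v = v * v + v * z * v := by noncomm_ring
    rw [this] at f1
    exact eq_sub_of_add_eq' f1
  have hsum : h + s * u * s = 1 - s * w * s := by
    have : s * u * s = s * s - s * w * s := by simp only [u]; noncomm_ring
    rw [this, hss]; abel
  refine ⟨l.map fun a => a * v, s, hs0.isSelfAdjoint, ?_, ?_⟩
  · rw [hc, hsum]
    have := star_left_conjugate_nonneg hw0 s
    rw [hs0.isSelfAdjoint.star_eq] at this
    simpa using this
  rw [hc, hsum]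
  -- bound of the conjugated term
  have b1 : ‖r * w‖ = ‖w * r‖ := by rw [← norm_star (r * w), star_mul, hws, hrs]
  have b2 : ‖y * w‖ = ‖w * star y‖ := by rw [← norm_star (y * w), star_mul, hws]
  have b3 : s * w * s = w + (- (r * w) - w * r + r * (w * r)) := by
    simp only [r]; noncomm_ring
  have b4 : ‖- (r * w) - w * r + r * (w * r)‖ ≤ 4 * δ := by
    have q1 := norm_add_le (- (r * w) - w * r) (r * (w * r))
    have q2 := norm_sub_le (- (r * w)) (w * r)
    have q3 : ‖r * (w * r)‖ ≤ 2 * δ :=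
      (norm_mul_le _ _).trans (mul_le_mul hrn k3.le (norm_nonneg _) (by norm_num))
    rw [norm_neg, b1] at q2
    linarith
  have b5 : (ω (s * w * s)).re ≤ (ω w).re + 4 * δ * ‖ω‖ := by
    rw [b3, map_add, Complex.add_re]
    have q1 := Complex.re_le_norm (ω (- (r * w) - w * r + r * (w * r)))
    have q2 := ω.le_opNorm (- (r * w) - w * r + r * (w * r))
    nlinarith [norm_nonneg ω]
  -- the element `y`
  have c1 : y = u * y * u + (w * y + u * (y * w)) := by simp only [u]; noncomm_ring
  have c2 : ‖w * y + u * (y * w)‖ ≤ 2 * δ := by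
    have q1 := norm_add_le (w * y) (u * (y * w))
    have q3 : ‖u * (y * w)‖ ≤ 1 * δ :=
      (norm_mul_le _ _).trans (mul_le_mul hun (by rw [b2]; exact k2.le) (norm_nonneg _) (by norm_num))
    linarith
  have c3 : ‖ω (u * y * u)‖ ≤ (ω u).re := by
    have q := posf_norm_apply (posf_comp_emL hω [u]) y
    simp only [ContinuousLinearMap.comp_apply, emL_cons, emL_nil, add_zero, hus, mul_one] at q
    have q2 : u * u ≤ u := by
      have := CStarAlgebra.pow_antitone hu0 hu1 (show 1 ≤ 2 by norm_num)
      simpa [pow_two] using this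
    have q3 := posf_mono_re hω q2
    have q4 := (Complex.le_def.1 (posf_nonneg hω (sa_mul_self_nonneg hu0.isSelfAdjoint))).1
    simp only [Complex.zero_re] at q4
    nlinarith [norm_nonneg y]
  have c4 : ‖ω y‖ ≤ (ω u).re + 2 * δ * ‖ω‖ := by
    have q0 := congrArg ω c1
    rw [map_add] at q0
    rw [q0]
    have q1 := norm_add_le (ω (u * y * u)) (ω (w * y + u * (y * w)))
    have q2 := ω.le_opNorm (w * y + u * (y * w))
    nlinarith [norm_nonneg ω]
  have d1 : (ω u).re = (ω 1).re - (ω w).re := by simp [u]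
  rw [map_sub, Complex.sub_re]
  linarith

lemma emL_fix (l : List B) {g : B} (h : ∀ a ∈ l, g * a = a) : emL l g = emL l 1 := by
  induction l with
  | nil => simp [emL_nil]
  | cons a l ih =>
    rw [emL_cons, emL_cons, ih (fun b hb => h b (by simp [hb])), mul_assoc, h a (by simp), mul_one]

lemma chain {ω ρ : B →L[ℂ] ℂ} (hω : IsPositiveFunctional ω)
    (hJ : ∀ J : Set B, IsClosedIdeal J → normRestrict ρ J ≤ normRestrict ω J)
    (e : ℕ → B) (he0 : ∀ j, 0 ≤ e j) (he1 : ∀ j, e j ≤ 1) (hee : ∀ j, e (j + 1) * e j = e j)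
    {ε : ℝ} (hε : 0 < ε) (m : ℕ) : ∃ l : List B, emL l 1 ≤ 1 ∧ (∀ a ∈ l, e m * a = a) ∧
      ∀ j < m, (ρ (e j)).re - ε ≤ (ω (emL l (e (j + 1)))).re := by
  induction m with
  | zero => exact ⟨[], by simp [emL_nil], by simp, by simp⟩
  | succ m ih =>
    obtain ⟨l, h1, h2, h3⟩ := ih
    have hmem : emL l 1 ∈ genIdeal (e m) := by
      rw [← emL_fix l h2]
      exact emL_mem (genIdeal_closedIdeal _) l (self_mem_genIdeal _)
    have hem := (he0 m).isSelfAdjoint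
    obtain ⟨c, s, hs, k1, k2⟩ := step_core hω hem (emL_nonneg l zero_le_one) h1 hmem hε
    let l' := l ++ (c.map (fun a => e m * a)).map (fun a => a * s)
    have hl' : emL l' 1 = emL l 1 + s * emL c (e m * e m) * s := by
      simp only [l', emL_append, emL_map_mul, emL_map_mul_left, hs.star_eq, hem.star_eq, mul_one]
    have hfix : ∀ a ∈ l', e (m + 1) * a = a := by
      intro a ha
      rcases List.mem_append.1 ha with ha | ha
      · rw [← h2 a ha, ← mul_assoc, hee]
      · simp only [List.map_map, List.mem_map, Function.comp_apply] at ha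
        obtain ⟨b, -, rfl⟩ := ha
        rw [← mul_assoc, ← mul_assoc, hee]
    refine ⟨l', by rw [hl']; exact k1, hfix, fun j hj => ?_⟩
    rcases Nat.lt_succ_iff_lt_or_eq.1 hj with hj | rfl
    · refine (h3 j hj).trans (posf_mono_re hω ?_)
      simp only [l', emL_append]
      exact le_add_of_nonneg_right (emL_nonneg _ (he0 _))
    · rw [emL_fix l' hfix, hl']
      refine le_trans ?_ k2
      have q1 := le_normRestrict ρ (self_mem_genIdeal (e j) : e j ∈ (genIdeal (e j) : Set B))
        (norm_le_one_of (he0 j) (he1 j))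
      have q2 := hJ _ (genIdeal_closedIdeal (e j))
      have q3 := Complex.re_le_norm (ρ (e j))
      linarith

/-- clamp to the unit interval -/
def clamp (t : ℝ) : ℝ := max 0 (min 1 t)

lemma clamp_cont : Continuous clamp := by unfold clamp; fun_prop

lemma clamp_mul (t : ℝ) : clamp (t + 1) * clamp t = clamp t := by
  unfold clamp
  rcases le_total t 0 with h | h
  · rw [max_eq_left (b := min 1 t) (by simp [h])]; simp
  · rw [min_eq_left (b := t + 1) (by linarith)]; simp

lemma clamp_sum (N : ℕ) (y : ℝ) (h1 : y ≤ N) :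
    ∑ j ∈ Finset.range N, clamp (y - N + ((j + 1 : ℕ) : ℝ)) = max y 0 := by
  induction N generalizing y with
  | zero => simp at h1; simp [h1]
  | succ N ih =>
    rw [Finset.sum_range_succ]
    rcases le_total y 1 with h | h
    · rw [Finset.sum_eq_zero]
      · unfold clamp; push_cast
        rw [zero_add, sub_add_cancel, min_eq_right h, max_comm]
      · intro j hj
        have : (j : ℝ) + 1 ≤ N := by exact_mod_cast Finset.mem_range.1 hj
        unfold clamp; push_cast
        apply max_eq_left
        apply (min_le_right _ _).trans
        linarith
    · have := ih (y - 1) (by push_cast at h1; linarith)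
      have e1 : ∀ j : ℕ, y - ((N + 1 : ℕ) : ℝ) + ((j + 1 : ℕ) : ℝ) = y - 1 - N + ((j + 1 : ℕ) : ℝ) := by
        intro j; push_cast; ring
      simp only [e1] at *
      rw [this]
      unfold clamp; push_cast
      rw [max_eq_left (by linarith), min_eq_left (by linarith), max_eq_right (by norm_num : (0:ℝ) ≤ 1),
        max_eq_left (by linarith)]
      ring

lemma complete_unital {ω : B →L[ℂ] ℂ} (hω : IsPositiveFunctional ω) (l : List B)
    (hl : emL l 1 ≤ 1) {x : B} (hx : 0 ≤ x) :
    ∃ l' : List B, emL l' 1 = 1 ∧ (ω (emL l x)).re ≤ (ω (emL l' x)).re := by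
  refine ⟨CFC.sqrt (1 - emL l 1) :: l, ?_, ?_⟩
  · rw [emL_cons, (CFC.sqrt_nonneg _).isSelfAdjoint.star_eq, mul_one,
      CFC.sqrt_mul_sqrt_self _ (sub_nonneg.2 hl)]
    simp
  · refine posf_mono_re hω ?_
    rw [emL_cons]
    exact le_add_of_nonneg_left (star_left_conjugate_nonneg hx _)

lemma layer {ω ρ : B →L[ℂ] ℂ} (hω : IsPositiveFunctional ω) (hρ : IsPositiveFunctional ρ)
    (hJ : ∀ J : Set B, IsClosedIdeal J → normRestrict ρ J ≤ normRestrict ω J)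
    {x : B} (hx0 : 0 ≤ x) (hx1 : x ≤ 1) {ε : ℝ} (hε : 0 < ε) :
    ∃ l : List B, emL l 1 = 1 ∧ (ρ x).re - ε ≤ (ω (emL l x)).re := by
  obtain ⟨N, hN⟩ := exists_nat_gt ((ρ 1).re / (ε / 2))
  have hρ1 := posf_one_nonneg hρ
  have hN0 : 0 < (N : ℝ) := lt_of_le_of_lt (by positivity) hN
  rw [div_lt_iff₀ (by positivity)] at hN
  let g : ℕ → ℝ → ℝ := fun j t => clamp (N * t - N + j)
  have hg : ∀ j, Continuous (g j) := fun j => clamp_cont.comp (by fun_prop)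
  let e : ℕ → B := fun j => cfc (g j) x
  have hxs : IsSelfAdjoint x := hx0.isSelfAdjoint
  have he0 : ∀ j, 0 ≤ e j := fun j => cfc_nonneg fun t _ => le_max_left _ _
  have he1 : ∀ j, e j ≤ 1 := fun j => cfc_le_one _ _ fun t _ => max_le zero_le_one (min_le_left _ _)
  have hee : ∀ j, e (j + 1) * e j = e j := by
    intro j
    simp only [e]
    rw [← cfc_mul _ _ x (hg _).continuousOn (hg _).continuousOn]
    congr 1
    ext t
    simp only [g]; push_cast
    rw [← add_assoc, clamp_mul]
  have hsum : ∑ j ∈ Finset.range N, e (j + 1) = (N : ℝ) • x := by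
    simp only [e]
    rw [← cfc_sum (fun j => g (j + 1)) x (Finset.range N) (fun i _ => (hg _).continuousOn)]
    have : (N : ℝ) • x = cfc (fun t : ℝ => (N : ℝ) * t) x := by
      rw [cfc_const_mul_id (N : ℝ) x]
    rw [this]
    apply cfc_congr
    intro t ht
    have ht0 : 0 ≤ t := spectrum_nonneg_of_nonneg hx0 ht
    have ht1 : t ≤ 1 := by
      have := (cfc_le_one_iff (fun t : ℝ => t) x (by fun_prop) hxs).1 (by rwa [cfc_id' ℝ x]) t ht
      exact this
    simp only [g, Finset.sum_apply]
    rw [clamp_sum N (N * t) (by nlinarith), max_eq_left (by positivity)]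
  obtain ⟨l, h1, -, h3⟩ := chain hω hJ e he0 he1 hee (half_pos hε) N
  obtain ⟨l', k1, k2⟩ := complete_unital hω l h1 hx0
  refine ⟨l', k1, le_trans ?_ k2⟩
  have cs : ∀ f : B →L[ℂ] ℂ, (f ((N : ℝ) • x)).re = N * (f x).re := by
    intro f
    rw [← Complex.coe_smul, map_smul, smul_eq_mul]; simp
  have hA : N * (ω (emL l x)).re = ∑ j ∈ Finset.range N, (ω (emL l (e (j + 1)))).re := by
    refine (cs (ω.comp (emL l))).symm.trans ?_
    rw [← hsum, map_sum, Complex.re_sum]; rfl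
  have hB : N * (ρ x).re = ∑ j ∈ Finset.range N, (ρ (e (j + 1))).re := by
    rw [← cs ρ, ← hsum, map_sum, Complex.re_sum]
  have hC : ∑ j ∈ Finset.range N, ((ρ (e j)).re - ε / 2) ≤ N * (ω (emL l x)).re := by
    rw [hA]
    exact Finset.sum_le_sum fun j hj => h3 j (Finset.mem_range.1 hj)
  have hD : ∑ j ∈ Finset.range N, (ρ (e (j + 1))).re - ∑ j ∈ Finset.range N, (ρ (e j)).re
      = (ρ (e N)).re - (ρ (e 0)).re := by
    rw [← Finset.sum_sub_distrib, Finset.sum_range_sub (fun j => (ρ (e j)).re)]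
  have hE := posf_mono_re hρ (he1 N)
  have hF := posf_mono_re hρ (he0 0)
  simp only [map_zero, Complex.zero_re] at hF
  rw [Finset.sum_sub_distrib] at hC
  simp only [Finset.sum_const, Finset.card_range, nsmul_eq_mul] at hC
  have : N * ((ρ x).re - ε) ≤ N * (ω (emL l x)).re := by nlinarith
  exact le_of_mul_le_mul_left this hN0

lemma layer_sa {ω ρ : B →L[ℂ] ℂ} (hω : IsPositiveFunctional ω) (hρ : IsPositiveFunctional ρ)
    (h1 : ρ 1 = ω 1)
    (hJ : ∀ J : Set B, IsClosedIdeal J → normRestrict ρ J ≤ normRestrict ω J)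
    {x : B} (hx : IsSelfAdjoint x) {ε : ℝ} (hε : 0 < ε) :
    ∃ l : List B, emL l 1 = 1 ∧ (ρ x).re - ε ≤ (ω (emL l x)).re := by
  let M : ℝ := ‖x‖ + 1
  have hM : 0 < M := by positivity
  have hle : x ≤ algebraMap ℝ B M := sa_le_of_norm hx (by simp [M])
  have hge : 0 ≤ x + algebraMap ℝ B M := by
    have := sa_le_of_norm hx.neg (r := M) (by simp [M])
    simpa [add_comm] using sub_nonneg.2 this
  let k : ℝ := 1 / (2 * M)
  have hk : 0 < k := by positivity
  let x' := k • (x + algebraMap ℝ B M)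
  have hx0 : 0 ≤ x' := smul_nonneg hk.le hge
  have hx1 : x' ≤ 1 := by
    have : k • (algebraMap ℝ B M + algebraMap ℝ B M) = 1 := by
      rw [← map_add, Algebra.algebraMap_eq_smul_one, smul_smul]
      have : k * (M + M) = 1 := by simp only [k]; field_simp; norm_num
      rw [this, one_smul]
    rw [← this]
    exact smul_le_smul_of_nonneg_left (by gcongr) hk.le
  have hf : ∀ f : B →L[ℂ] ℂ, (f x').re = k * ((f x).re + M * (f 1).re) := by
    intro f
    simp only [x']
    rw [← Complex.coe_smul, map_smul, map_add, f_algebraMap, smul_eq_mul]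
    simp
  obtain ⟨l, hl1, hl⟩ := layer hω hρ hJ hx0 hx1 (ε := k * ε) (by positivity)
  refine ⟨l, hl1, ?_⟩
  have a1 := hf ρ
  have a2 := hf (ω.comp (emL l))
  simp only [ContinuousLinearMap.comp_apply, hl1] at a2
  rw [a1, a2, h1] at hl
  have : k * ((ρ x).re - ε) ≤ k * (ω (emL l x)).re := by linarith
  exact le_of_mul_le_mul_left this hk

lemma emL_smul_one (l : List B) {a : ℝ} (ha : 0 ≤ a) (x : B) :
    emL (l.map fun b => b * ((√a : ℂ) • (1 : B))) x = (a : ℂ) • emL l x := by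
  rw [emL_map_mul]
  have : (√a : ℂ) * (√a : ℂ) = (a : ℂ) := by
    rw [← Complex.ofReal_mul, Real.mul_self_sqrt ha]
  simp [smul_smul, Real.mul_self_sqrt ha]

lemma closure_of_pos {ω ρ : B →L[ℂ] ℂ} (hω : IsPositiveFunctional ω) (hρ : IsPositiveFunctional ρ)
    (h1 : ρ 1 = ω 1)
    (hJ : ∀ J : Set B, IsClosedIdeal J → normRestrict ρ J ≤ normRestrict ω J) :
    InWeakStarClosure (mixSet ω) ρ := by
  intro ε hε n x
  let K : Set (Fin n → ℂ) := {v | ∃ l : List B, emL l 1 = 1 ∧ v = fun i => ω (emL l (x i))}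
  have hK : Convex ℝ K := by
    rintro _ ⟨l, hl, rfl⟩ _ ⟨m, hm, rfl⟩ a b ha hb hab
    refine ⟨(l.map fun c => c * ((√a : ℂ) • (1 : B))) ++ (m.map fun c => c * ((√b : ℂ) • (1 : B))),
      ?_, ?_⟩
    · rw [emL_append, emL_smul_one l ha, emL_smul_one m hb, hl, hm, ← add_smul,
        ← Complex.ofReal_add, hab]
      simp
    · ext i
      rw [emL_append, emL_smul_one l ha, emL_smul_one m hb]
      simp
  by_cases hp : (fun i => ρ (x i)) ∈ closure K
  · rw [Metric.mem_closure_iff] at hp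
    obtain ⟨_, ⟨l, hl, rfl⟩, hd⟩ := hp ε hε
    refine ⟨_, ⟨_, emL_ucp l hl, rfl⟩, fun i => ?_⟩
    have := (dist_pi_lt_iff hε).1 hd i
    rwa [dist_eq_norm] at this
  · exfalso
    obtain ⟨f, u, hf1, hf2⟩ := RCLike.geometric_hahn_banach_closed_point (𝕜 := ℂ) hK.closure
      isClosed_closure hp
    let X : B := ∑ i, f (Pi.single i 1) • x i
    have hfX : ∀ g : B →L[ℂ] ℂ, f (fun i => g (x i)) = g X := by
      intro g
      have : (fun i => g (x i)) = ∑ i, g (x i) • (Pi.single i (1 : ℂ) : Fin n → ℂ) := by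
        ext j
        simp [Finset.sum_apply, Pi.single_apply]
      rw [this, map_sum, map_sum]
      refine Finset.sum_congr rfl fun i _ => ?_
      rw [map_smul, map_smul, smul_eq_mul, smul_eq_mul, mul_comm]
    let Y : B := (1/2 : ℂ) • (X + star X)
    have hY : IsSelfAdjoint Y := half_sa X
    rw [hfX ρ] at hf2
    have hf2' : u < (ρ X).re := hf2
    obtain ⟨l, hl, hl2⟩ := layer_sa hω hρ h1 hJ hY (sub_pos.2 hf2')
    have hf3 := hf1 _ (subset_closure ⟨l, hl, rfl⟩)
    have e1 := hfX (ω.comp (emL l))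
    simp only [ContinuousLinearMap.comp_apply] at e1
    rw [e1] at hf3
    have hf3' : (ω (emL l X)).re < u := hf3
    have e2 : (ρ Y).re = (ρ X).re := by rw [herm_re (posf_star hρ)]; simp
    have e3 : (ω (emL l Y)).re = (ω (emL l X)).re := by
      have := herm_re (posf_star (posf_comp_emL hω l)) X
      simp only [ContinuousLinearMap.comp_apply] at this
      rw [this]; simp
    rw [e2, e3] at hl2
    linarith

lemma perturb {f : B →L[ℂ] ℂ} (hf : IsPositiveFunctional f) {d : B} (hd0 : 0 ≤ d) (hd1 : d ≤ 1)
    {δ : ℝ} (hδ : (f (1 - d)).re ≤ δ) {F : ℝ} (hF : (f 1).re ≤ F) (Y : B) :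
    ‖f Y - f (CFC.sqrt d * Y * CFC.sqrt d)‖ ≤ 2 * (√(δ * F) * ‖Y‖) ∧
    ‖f (CFC.sqrt (1 - d) * Y * CFC.sqrt (1 - d))‖ ≤ δ * ‖Y‖ := by
  have hd1' : 0 ≤ 1 - d := sub_nonneg.2 hd1
  constructor
  · set s := CFC.sqrt d with hs
    have hs0 : 0 ≤ s := CFC.sqrt_nonneg _
    have hss : s * s = d := CFC.sqrt_mul_sqrt_self _ hd0
    have hsn : ‖s‖ ≤ 1 := by
      have h1 : ‖s * s‖ ≤ 1 := by rw [hss]; exact norm_le_one_of hd0 hd1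
      have h2 : ‖star s * s‖ = ‖s‖ * ‖s‖ := CStarRing.norm_star_mul_self
      rw [hs0.isSelfAdjoint.star_eq] at h2
      nlinarith [norm_nonneg s]
    have hs1 : s ≤ 1 := (CStarAlgebra.norm_le_one_iff_of_nonneg s hs0).1 hsn
    let r := 1 - s
    have hr : IsSelfAdjoint r := (sub_nonneg.2 hs1).isSelfAdjoint
    have hrr : r * r ≤ 1 - d := by
      have q2 : s * s ≤ s := by
        have := CStarAlgebra.pow_antitone hs0 hs1 (show 1 ≤ 2 by norm_num)
        simpa [pow_two] using this
      rw [← hss, ← sub_nonneg]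
      have : 1 - s * s - r * r = (s - s * s) + (s - s * s) := by simp only [r]; noncomm_ring
      rw [this]
      exact add_nonneg (sub_nonneg.2 q2) (sub_nonneg.2 q2)
    have key : ∀ Z : B, ‖Z‖ ≤ ‖Y‖ → ‖f (r * Z)‖ ≤ √(δ * F) * ‖Y‖ := by
      intro Z hZ
      have c := posf_cs hf r Z
      rw [hr.star_eq] at c
      have a1 : (f (r * r)).re ≤ δ := (posf_mono_re hf hrr).trans hδ
      have a0 : 0 ≤ (f (r * r)).re := (Complex.le_def.1 (posf_nonneg hf (sa_mul_self_nonneg hr))).1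
      have a2 : (f (star Z * Z)).re ≤ F * ‖Y‖ ^ 2 := by
        refine (Complex.re_le_norm _).trans ((posf_norm_apply hf _).trans ?_)
        rw [CStarRing.norm_star_mul_self, ← pow_two]
        have := posf_one_nonneg hf
        have hF0 : 0 ≤ F := this.trans hF
        gcongr
      have a3 : ‖f (r * Z)‖ ^ 2 ≤ (δ * F) * ‖Y‖ ^ 2 := by
        refine c.trans ?_
        rw [mul_assoc]
        have := (Complex.le_def.1 (posf_nonneg hf (star_mul_self_nonneg Z))).1
        simp only [Complex.zero_re] at this
        exact mul_le_mul a1 a2 this (a0.trans a1)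
      have a4 := Real.le_sqrt_of_sq_le a3
      have hF0 := (posf_one_nonneg hf).trans hF
      rwa [Real.sqrt_mul (mul_nonneg (a0.trans a1) hF0), Real.sqrt_sq (norm_nonneg _)] at a4
    have b1 : f Y - f (s * Y * s) = f (r * Y) + f (s * Y * r) := by
      rw [← map_sub, ← map_add]; congr 1; simp only [r]; noncomm_ring
    have b2 : ‖f (s * Y * r)‖ = ‖f (r * (star Y * s))‖ := by
      have := posf_star hf (s * Y * r)
      have h2 : star (s * Y * r) = r * (star Y * s) := by
        simp [hs0.isSelfAdjoint.star_eq, hr.star_eq]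
      rw [h2] at this
      rw [this, Complex.norm_conj]
    have b3 : ‖star Y * s‖ ≤ ‖Y‖ := (norm_mul_le _ _).trans (by
      rw [norm_star]; exact mul_le_of_le_one_right (norm_nonneg _) hsn)
    rw [b1]
    refine (norm_add_le _ _).trans ?_
    rw [b2]
    have := key Y le_rfl
    have := key _ b3
    linarith
  · set s := CFC.sqrt (1 - d) with hs
    have hs0 : 0 ≤ s := CFC.sqrt_nonneg _
    have hss : s * s = 1 - d := CFC.sqrt_mul_sqrt_self _ hd1'
    have q := posf_norm_apply (posf_comp_emL hf [s]) Y
    simp only [ContinuousLinearMap.comp_apply, emL_cons, emL_nil, add_zero,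
      hs0.isSelfAdjoint.star_eq, mul_one, hss] at q
    exact q.trans (by gcongr)

lemma jordan_elem {ω ωp ωm : B →L[ℂ] ℂ} (hω : IsHermitianFunctional ω)
    (hJ : IsJordanDecomposition ω ωp ωm) {δ : ℝ} (hδ : 0 < δ) :
    ∃ c : B, 0 ≤ c ∧ c ≤ 1 ∧ (ωp (1 - c)).re ≤ δ ∧ (ωm c).re ≤ δ := by
  obtain ⟨hp, hm, hsub, hn⟩ := hJ
  obtain ⟨x0, hx0, hx1⟩ := ω.exists_lt_apply_of_lt_opNorm (show ‖ω‖ - δ < ‖ω‖ by linarith)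
  obtain ⟨y, hy, hyn, hyv⟩ := herm_exists_sa hω x0
  have hy1 : ‖y‖ ≤ 1 := hyn.trans hx0.le
  have h1 : y ≤ 1 := by simpa using sa_le_of_norm hy hy1
  have h2 : -y ≤ 1 := by simpa using sa_le_of_norm hy.neg (r := 1) (by simpa using hy1)
  have h3 : 0 ≤ 1 + y := by simpa [add_comm] using sub_nonneg.2 h2
  have h4 : 0 ≤ 1 - y := sub_nonneg.2 h1
  let c : B := (1/2 : ℝ) • (1 + y)
  have hc' : 1 - c = (1/2 : ℝ) • (1 - y) := by
    have : (1 : B) = (1/2 : ℝ) • (1 + 1 : B) := by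
      rw [← two_smul ℝ (1 : B), smul_smul]; norm_num
    simp only [c]
    nth_rewrite 1 [this]
    rw [← smul_sub]; congr 1; abel
  have cs : ∀ (f : B →L[ℂ] ℂ) (z : B), (f ((1/2 : ℝ) • z)).re = 1/2 * (f z).re := by
    intro f z
    rw [← Complex.coe_smul, map_smul, smul_eq_mul, Complex.re_ofReal_mul]
  have hv : ‖ω‖ - δ < (ωp y).re - (ωm y).re := by
    have h5 : (ω y).re = ‖ω x0‖ := by rw [hyv]; simp
    have h6 : (ω y).re = (ωp y).re - (ωm y).re := by rw [hsub]; simp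
    linarith
  rw [hn, posf_norm hp, posf_norm hm] at hv
  have n1 := (Complex.le_def.1 (posf_nonneg hp h4)).1
  have n2 := (Complex.le_def.1 (posf_nonneg hm h3)).1
  simp only [map_sub, map_add, Complex.sub_re, Complex.add_re, Complex.zero_re] at n1 n2
  refine ⟨c, smul_nonneg (by norm_num) h3, ?_, ?_, ?_⟩
  · rw [← sub_nonneg, hc']; exact smul_nonneg (by norm_num) h4
  · rw [hc', cs, map_sub, Complex.sub_re]; linarith
  · simp only [c]; rw [cs, map_add, Complex.add_re]; linarith

open Filter Topology in
lemma exists_small (F M : ℝ) {ε : ℝ} (hε : 0 < ε) :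
    ∃ δ > 0, (2 * (√(δ * F) * M) + δ * M) < ε := by
  have hc : Continuous fun δ : ℝ => (2 * (√(δ * F) * M) + δ * M) := by fun_prop
  have ht := hc.tendsto 0
  have hev : ∀ᶠ δ in 𝓝 (0:ℝ), (2 * (√(δ * F) * M) + δ * M) < ε :=
    ht.eventually_lt_const (by simpa using hε)
  obtain ⟨δ, h1, h2⟩ := ((hev.filter_mono nhdsWithin_le_nhds).and
    (self_mem_nhdsWithin : Set.Ioi (0:ℝ) ∈ 𝓝[>] 0)).exists
  exact ⟨δ, h2, h1⟩

lemma closure_combine {ω ωp ωm ρ₁ ρ₂ : B →L[ℂ] ℂ} (hω : IsHermitianFunctional ω)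
    (hJ : IsJordanDecomposition ω ωp ωm) (h1 : InWeakStarClosure (mixSet ωp) ρ₁)
    (h2 : InWeakStarClosure (mixSet ωm) ρ₂) : InWeakStarClosure (mixSet ω) (ρ₁ - ρ₂) := by
  intro ε hε n x
  let M : ℝ := ∑ i, ‖x i‖
  have hM : ∀ i, ‖x i‖ ≤ M := fun i =>
    Finset.single_le_sum (f := fun i => ‖x i‖) (fun _ _ => norm_nonneg _) (Finset.mem_univ i)
  let F : ℝ := max (ωp 1).re (ωm 1).re
  obtain ⟨δ, hδ, hδ2⟩ := exists_small F M (show 0 < ε / 4 by positivity)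
  obtain ⟨c, hc0, hc1, hcp, hcm⟩ := jordan_elem hω hJ hδ
  obtain ⟨hp, hm, hsub, -⟩ := hJ
  obtain ⟨_, ⟨_, hφ, rfl⟩, e1⟩ := h1 (ε / 4) (by positivity) n x
  obtain ⟨_, ⟨_, hψ, rfl⟩, e2⟩ := h2 (ε / 4) (by positivity) n x
  obtain ⟨l, rfl, hl⟩ := exists_emL_of_ucp hφ
  obtain ⟨m, rfl, hm1⟩ := exists_emL_of_ucp hψ
  have hd0 : 0 ≤ 1 - c := sub_nonneg.2 hc1
  have hd1 : 1 - c ≤ 1 := by simpa using hc0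
  let s := CFC.sqrt c
  let t := CFC.sqrt (1 - c)
  have hs : star s = s := (CFC.sqrt_nonneg c).isSelfAdjoint.star_eq
  have ht : star t = t := (CFC.sqrt_nonneg (1 - c)).isSelfAdjoint.star_eq
  let L := (l.map fun a => a * s) ++ (m.map fun a => a * t)
  have hL : ∀ y, emL L y = s * emL l y * s + t * emL m y * t := by
    intro y
    simp only [L, emL_append, emL_map_mul, hs, ht]
  have hL1 : emL L 1 = 1 := by
    rw [hL, hl, hm1, mul_one, mul_one]
    simp only [s, t]
    rw [CFC.sqrt_mul_sqrt_self _ hc0, CFC.sqrt_mul_sqrt_self _ hd0]; simp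
  refine ⟨_, ⟨_, emL_ucp L hL1, rfl⟩, fun i => ?_⟩
  have nl := (emL_norm_le l hl (x i)).trans (hM i)
  have nm := (emL_norm_le m hm1 (x i)).trans (hM i)
  obtain ⟨a1, -⟩ := perturb hp hc0 hc1 hcp (le_max_left _ (ωm 1).re) (emL l (x i))
  obtain ⟨-, a2⟩ := perturb hp hc0 hc1 hcp (le_max_left _ (ωm 1).re) (emL m (x i))
  obtain ⟨b1, -⟩ := perturb hm hd0 hd1 (by simpa using hcm) (le_max_right (ωp 1).re _) (emL m (x i))
  obtain ⟨-, b2⟩ := perturb hm hd0 hd1 (by simpa using hcm) (le_max_right (ωp 1).re _) (emL l (x i))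
  rw [sub_sub_cancel] at b2
  have g1 := e1 i
  have g2 := e2 i
  simp only [ContinuousLinearMap.comp_apply] at g1 g2 ⊢
  have hq1 : 2 * (√(δ * F) * ‖emL l (x i)‖) ≤ 2 * (√(δ * F) * M) := by gcongr
  have hq2 : 2 * (√(δ * F) * ‖emL m (x i)‖) ≤ 2 * (√(δ * F) * M) := by gcongr
  have hq3 : δ * ‖emL l (x i)‖ ≤ δ * M := by gcongr
  have hq4 : δ * ‖emL m (x i)‖ ≤ δ * M := by gcongr
  have hdec : (ρ₁ - ρ₂) (x i) - ω (emL L (x i)) =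
      (ρ₁ (x i) - ωp (emL l (x i))) - (ρ₂ (x i) - ωm (emL m (x i)))
      + (ωp (emL l (x i)) - ωp (s * emL l (x i) * s)) - ωp (t * emL m (x i) * t)
      - (ωm (emL m (x i)) - ωm (t * emL m (x i) * t)) + ωm (s * emL l (x i) * s) := by
    rw [hL, hsub]
    simp only [ContinuousLinearMap.sub_apply, map_add]
    ring
  rw [hdec]
  have t1 := norm_add_le ((ρ₁ (x i) - ωp (emL l (x i))) - (ρ₂ (x i) - ωm (emL m (x i)))
      + (ωp (emL l (x i)) - ωp (s * emL l (x i) * s)) - ωp (t * emL m (x i) * t)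
      - (ωm (emL m (x i)) - ωm (t * emL m (x i) * t))) (ωm (s * emL l (x i) * s))
  have t2 := norm_sub_le ((ρ₁ (x i) - ωp (emL l (x i))) - (ρ₂ (x i) - ωm (emL m (x i)))
      + (ωp (emL l (x i)) - ωp (s * emL l (x i) * s)) - ωp (t * emL m (x i) * t))
      (ωm (emL m (x i)) - ωm (t * emL m (x i) * t))
  have t3 := norm_sub_le ((ρ₁ (x i) - ωp (emL l (x i))) - (ρ₂ (x i) - ωm (emL m (x i)))
      + (ωp (emL l (x i)) - ωp (s * emL l (x i) * s))) (ωp (t * emL m (x i) * t))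
  have t4 := norm_add_le ((ρ₁ (x i) - ωp (emL l (x i))) - (ρ₂ (x i) - ωm (emL m (x i))))
      (ωp (emL l (x i)) - ωp (s * emL l (x i) * s))
  have t5 := norm_sub_le (ρ₁ (x i) - ωp (emL l (x i))) (ρ₂ (x i) - ωm (emL m (x i)))
  linarith

lemma pos_of_norm_le {ρ : B →L[ℂ] ℂ} (hρ : IsHermitianFunctional ρ) (h : ‖ρ‖ ≤ (ρ 1).re) :
    IsPositiveFunctional ρ := by
  intro a
  set p := star a * a with hp
  have hp0 : 0 ≤ p := star_mul_self_nonneg a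
  have him : (ρ p).im = 0 := by
    have := hρ p
    rw [hp0.isSelfAdjoint.star_eq] at this
    exact Complex.conj_eq_iff_im.1 this.symm
  have hle : p ≤ algebraMap ℝ B ‖p‖ := hp0.isSelfAdjoint.le_algebraMap_norm_self
  have hn : ‖algebraMap ℝ B ‖p‖ - p‖ ≤ ‖p‖ := by
    rw [CStarAlgebra.norm_le_iff_le_algebraMap _ (norm_nonneg _) (sub_nonneg.2 hle)]
    simpa using hp0
  have h1 := ρ.le_opNorm (algebraMap ℝ B ‖p‖ - p)
  have h2 := Complex.re_le_norm (ρ (algebraMap ℝ B ‖p‖ - p))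
  rw [map_sub, f_algebraMap, Complex.sub_re, Complex.re_ofReal_mul] at h2
  rw [map_sub, f_algebraMap] at h1
  rw [Complex.le_def]
  refine ⟨?_, by simp [him]⟩
  have h3 : ‖ρ‖ * ‖algebraMap ℝ B ‖p‖ - p‖ ≤ (ρ 1).re * ‖p‖ :=
    mul_le_mul h hn (norm_nonneg _) ((norm_nonneg _).trans h)
  simp only [Complex.zero_re]
  linarith

lemma univ_closedIdeal : IsClosedIdeal (Set.univ : Set B) :=
  ⟨isClosed_univ, by simp, by simp, by simp, by simp⟩

lemma norm_le_normRestrict_univ (f : B →L[ℂ] ℂ) : ‖f‖ ≤ normRestrict f (Set.univ : Set B) := by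
  by_contra! hc
  obtain ⟨x, hx, hx2⟩ := f.exists_lt_apply_of_lt_opNorm hc
  exact absurd (le_normRestrict f (Set.mem_univ x) hx.le) (not_le.2 hx2)

lemma normRestrict_univ_le (f : B →L[ℂ] ℂ) : normRestrict f (Set.univ : Set B) ≤ ‖f‖ :=
  normRestrict_le f univ_closedIdeal fun x _ hx =>
    (f.le_opNorm x).trans (mul_le_of_le_one_right (norm_nonneg _) hx)

theorem main_aux
    (ω ρ ωp ωm : B →L[ℂ] ℂ) (hω : IsHermitianFunctional ω)
    (hρ : IsHermitianFunctional ρ) (hJordan : IsJordanDecomposition ω ωp ωm) :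
    (InWeakStarClosure (mixSet ω) ρ ↔
      ∃ ρ₁ ρ₂ : B →L[ℂ] ℂ, IsPositiveFunctional ρ₁ ∧ IsPositiveFunctional ρ₂ ∧
        ρ = ρ₁ - ρ₂ ∧ ρ₁ 1 = ωp 1 ∧ ρ₂ 1 = ωm 1 ∧
        ∀ J : Set B, IsClosedIdeal J →
          normRestrict ρ₁ J ≤ normRestrict ωp J ∧ normRestrict ρ₂ J ≤ normRestrict ωm J) ∧
    (InWeakStarClosure (mixSet ω) ρ →
      ∀ J : Set B, IsClosedIdeal J → normRestrict ρ J ≤ normRestrict ω J) ∧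
    (IsPositiveFunctional ω →
      (InWeakStarClosure (mixSet ω) ρ ↔
        ρ 1 = ω 1 ∧ ∀ J : Set B, IsClosedIdeal J → normRestrict ρ J ≤ normRestrict ω J)) := by
  refine ⟨⟨fun h => ?_, ?_⟩, fun h J hJ => closure_normRestrict h hJ, fun hpos => ⟨fun h =>
    ⟨closure_one h, fun J hJ => closure_normRestrict h hJ⟩, ?_⟩⟩
  · obtain ⟨ρ₁, ρ₂, hs, h1, h2⟩ := closure_split hJordan.2.2.1 h
    exact ⟨ρ₁, ρ₂, closure_pos hJordan.1 h1, closure_pos hJordan.2.1 h2, hs, closure_one h1,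
      closure_one h2, fun J hJ => ⟨closure_normRestrict h1 hJ, closure_normRestrict h2 hJ⟩⟩
  · rintro ⟨ρ₁, ρ₂, p1, p2, rfl, o1, o2, hJ⟩
    exact closure_combine hω hJordan
      (closure_of_pos hJordan.1 p1 o1 fun J h => (hJ J h).1)
      (closure_of_pos hJordan.2.1 p2 o2 fun J h => (hJ J h).2)
  · rintro ⟨h1, hJ⟩
    refine closure_of_pos hpos (pos_of_norm_le hρ ?_) h1 hJ
    rw [h1, ← posf_norm hpos]
    exact (norm_le_normRestrict_univ ρ).trans
      ((hJ _ univ_closedIdeal).trans (normRestrict_univ_le ω))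

end helpers

/-- **Theorem.** For hermitian functionals `ω`, `ρ` on a unital C*-algebra `A`
with Jordan decomposition `ω = ωp - ωm`: `ρ` lies in the weak* closure of
`ω ∘ E(A)` iff there exist positive functionals `ρ₁`, `ρ₂` with `ρ = ρ₁ - ρ₂`,
`ρ₁(1) = ωp(1)`, `ρ₂(1) = ωm(1)`, and `‖ρ₁|J‖ ≤ ‖ωp|J‖`, `‖ρ₂|J‖ ≤ ‖ωm|J‖`
for all closed two-sided ideals `J` (in particular `‖ρ|J‖ ≤ ‖ω|J‖`).
If `ω` is positive, the condition simplifies to `ρ(1) = ω(1)` together with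
`‖ρ|J‖ ≤ ‖ω|J‖` for all closed two-sided ideals `J`. -/
theorem hermitian_mem_weakStarClosure_mixSet_iff
    (ω ρ ωp ωm : A →L[ℂ] ℂ) (hω : IsHermitianFunctional ω)
    (hρ : IsHermitianFunctional ρ) (hJordan : IsJordanDecomposition ω ωp ωm) :
    (InWeakStarClosure (mixSet ω) ρ ↔
      ∃ ρ₁ ρ₂ : A →L[ℂ] ℂ, IsPositiveFunctional ρ₁ ∧ IsPositiveFunctional ρ₂ ∧
        ρ = ρ₁ - ρ₂ ∧ ρ₁ 1 = ωp 1 ∧ ρ₂ 1 = ωm 1 ∧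
        ∀ J : Set A, IsClosedIdeal J →
          normRestrict ρ₁ J ≤ normRestrict ωp J ∧ normRestrict ρ₂ J ≤ normRestrict ωm J) ∧
    (InWeakStarClosure (mixSet ω) ρ →
      ∀ J : Set A, IsClosedIdeal J → normRestrict ρ J ≤ normRestrict ω J) ∧
    (IsPositiveFunctional ω →
      (InWeakStarClosure (mixSet ω) ρ ↔
        ρ 1 = ω 1 ∧ ∀ J : Set A, IsClosedIdeal J → normRestrict ρ J ≤ normRestrict ω J)) := by
  letI : CStarAlgebra A := {}
  letI : PartialOrder A := CStarAlgebra.spectralOrder A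
  haveI : StarOrderedRing A := CStarAlgebra.spectralOrderedRing A
  exact main_aux ω ρ ωp ωm hω hρ hJordan

end
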